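/- Fix constants c ≥ 1 and κ > 0, and suppose z* is a solution at which MFCQ holds (so S is compact). Then there exist β₀ > 0, ε > 0 and C₁ > 0 such that the following holds for any μ > 0 and u > 0 with μ ≤ ε and u/μ ≤ ε. Let (z,λ) satisfy δ(z,λ) ≤ cμ; let D_B and D_N be positive diagonal matrices whose diagonal entries d satisfy c⁻¹μ ≤ d ≤ cμ (for D_B) and c⁻¹μ⁻¹ ≤ d ≤ cμ⁻¹ (for D_N); let perturbation matrices satisfy ‖Ẽ₁₁‖ ≤ κ(u/μ + μ) and ‖Ẽ₁₂‖, ‖Ẽ₂₁‖, ‖Ẽ₂₂‖ ≤ κu; and suppose that for some β ≥ β₀, σ_min(Σ) ≥ β·max(μ^{1/3}, u/μ) and σ_min(V̂ᵀL_zz(z*,λ*)V̂) ≥ β·max(μ^{1/3}, u/μ) for all λ* ∈ S_λ. Then any solution (w,y) of the linear system with coefficient matrix [[H(z,λ)+Ẽ₁₁, ∇g_B(z)+Ẽ₁₂],[∇g_B(z)ᵀ+Ẽ₂₁, −D_B+Ẽ₂₂]] and right-hand side (r₁, ∇g_B(z*)ᵀr₃ + r₄), where H(z,λ) = L_zz(z,λ)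 + ∇g_N(z)D_N⁻¹∇g_N(z)ᵀ, satisfies ‖Uᵀy‖ + ‖V̂ᵀw‖ + ‖Ûᵀw‖ ≤ C₁(‖r₁‖ + ‖r₃‖ + ‖r₄‖) and ‖Vᵀy‖ ≤ C₁(‖r₁‖ + ‖r₃‖ + ‖r₄‖/μ). -/

import Mathlib

open Matrix
open scoped BigOperators

noncomputable section

attribute [local instance] Classical.propDecidable

/-- Euclidean norm of a finitely indexed family of real numbers. -/
def evnorm {ι : Type*} [Fintype ι] (v : ι → ℝ) : ℝ :=
  Real.sqrt (∑ i, v i ^ 2)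

/-- Frobenius norm of a real matrix. -/
def mnorm {ι κ : Type*} [Fintype ι] [Fintype κ] (M : Matrix ι κ ℝ) : ℝ :=
  Real.sqrt (∑ i, ∑ j, M i j ^ 2)

/-- Smallest singular value of a real matrix. -/
def sigmaMin {ι κ : Type*} [Fintype ι] [Fintype κ] (M : Matrix ι κ ℝ) : ℝ :=
  sInf {t | ∃ x : κ → ℝ, evnorm x = 1 ∧ t = evnorm (M.mulVec x)}

/-- The continuous linear functional `x ↦ ⟨v, x⟩` on `ℝⁿ`. -/
def dotCLM {n : ℕ} (v : Fin n → ℝ) : (Fin n → ℝ) →L[ℝ] ℝ :=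
  ∑ i, v i • (ContinuousLinearMap.proj (R := ℝ) (φ := fun _ : Fin n => ℝ) i)

/-- The continuous linear map `x ↦ M x` on `ℝⁿ`. -/
def matCLM {n : ℕ} (M : Matrix (Fin n) (Fin n) ℝ) : (Fin n → ℝ) →L[ℝ] (Fin n → ℝ) :=
  LinearMap.toContinuousLinearMap (Matrix.toLin' M)

/-- Duality measure `μ(λ,s) = λᵀ s / m`. -/
def dmu {m : ℕ} (lam s : Fin m → ℝ) : ℝ := (∑ i, lam i * s i) / (m : ℝ)

/-- Data of the nonlinear program `min φ(z)  s.t.  g(z) ≤ 0`, with `φ` and each `gᵢ`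
twice Lipschitz continuously differentiable; `gradphi`, `gradg` are the gradients and
`hessphi`, `hessg` the (symmetric) Hessians. -/
structure NLP (n m : ℕ) where
  phi : (Fin n → ℝ) → ℝ
  g : Fin m → (Fin n → ℝ) → ℝ
  gradphi : (Fin n → ℝ) → Fin n → ℝ
  gradg : Fin m → (Fin n → ℝ) → Fin n → ℝ
  hessphi : (Fin n → ℝ) → Matrix (Fin n) (Fin n) ℝ
  hessg : Fin m → (Fin n → ℝ) → Matrix (Fin n) (Fin n) ℝ
  grad_phi : ∀ z, HasFDerivAt phi (dotCLM (gradphi z)) z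
  grad_g : ∀ i z, HasFDerivAt (g i) (dotCLM (gradg i z)) z
  hess_phi : ∀ z, HasFDerivAt gradphi (matCLM (hessphi z)) z
  hess_g : ∀ i z, HasFDerivAt (gradg i) (matCLM (hessg i z)) z
  hessphi_symm : ∀ z, (hessphi z).IsSymm
  hessg_symm : ∀ i z, (hessg i z).IsSymm
  lip_phi : ∃ K, ∀ z z', mnorm (hessphi z - hessphi z') ≤ K * evnorm (z - z')
  lip_g : ∀ i, ∃ K, ∀ z z', mnorm (hessg i z - hessg i z') ≤ K * evnorm (z - z')

namespace NLP

variable {n m : ℕ} (P : NLP n m)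

/-- Gradient of the Lagrangian with respect to `z`:  `L_z(z,λ) = ∇φ(z) + ∇g(z)λ`. -/
def Lz (z : Fin n → ℝ) (lam : Fin m → ℝ) : Fin n → ℝ :=
  fun j => P.gradphi z j + ∑ i, lam i * P.gradg i z j

/-- Hessian of the Lagrangian with respect to `z`. -/
def Lzz (z : Fin n → ℝ) (lam : Fin m → ℝ) : Matrix (Fin n) (Fin n) ℝ :=
  P.hessphi z + ∑ i, lam i • P.hessg i z

/-- The KKT conditions at `(z, λ)`. -/
def KKT (z : Fin n → ℝ) (lam : Fin m → ℝ) : Prop :=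
  P.Lz z lam = 0 ∧ (∀ i, P.g i z ≤ 0) ∧ (∀ i, 0 ≤ lam i) ∧ (∑ i, lam i * P.g i z) = 0

/-- The set `S_λ` of optimal Lagrange multipliers at `z*`. -/
def Slam (zstar : Fin n → ℝ) : Set (Fin m → ℝ) := {lam | P.KKT zstar lam}

/-- The Mangasarian–Fromovitz constraint qualification at `z*`. -/
def MFCQ (zstar : Fin n → ℝ) : Prop :=
  ∃ ybar : Fin n → ℝ, ∀ i, P.g i zstar = 0 → (∑ j, P.gradg i zstar j * ybar j) < 0

/-- The index set `B₊` of active constraints with a positive multiplier. -/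
def BPlus (zstar : Fin n → ℝ) : Set (Fin m) :=
  {i | P.g i zstar = 0 ∧ ∃ ls ∈ P.Slam zstar, 0 < ls i}

/-- The second-order sufficient condition at `z*`. -/
def SOC (zstar : Fin n → ℝ) : Prop :=
  ∃ ξ : ℝ, 0 < ξ ∧ ∀ ls ∈ P.Slam zstar, ∀ w : Fin n → ℝ,
    (∀ i, i ∈ P.BPlus zstar → (∑ j, P.gradg i zstar j * w j) = 0) →
    (∀ i, P.g i zstar = 0 → i ∉ P.BPlus zstar → (∑ j, P.gradg i zstar j * w j) ≤ 0) →
    ξ * evnorm w ^ 2 ≤ w ⬝ᵥ (P.Lzz zstar ls).mulVec w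

/-- The strict complementarity condition `B₊ = B` at `z*`. -/
def StrictComp (zstar : Fin n → ℝ) : Prop :=
  ∀ i, P.g i zstar = 0 → i ∈ P.BPlus zstar

/-- `z*` is a solution of the nonlinear program: it is feasible, it is a local
minimizer, and the first-order KKT conditions hold there. -/
def isSolution (zstar : Fin n → ℝ) : Prop :=
  (∀ i, P.g i zstar ≤ 0) ∧ (∃ lam, P.KKT zstar lam) ∧
  ∀ᶠ z in nhds zstar, (∀ i, P.g i z ≤ 0) → P.phi zstar ≤ P.phi z

/-- Euclidean distance `δ(z,λ)` from `(z,λ)` to the primal–dual solution set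
`S = {z*} × S_λ`. -/
def delta (zstar z : Fin n → ℝ) (lam : Fin m → ℝ) : ℝ :=
  sInf {d | ∃ ls ∈ P.Slam zstar,
    d = Real.sqrt (evnorm (z - zstar) ^ 2 + evnorm (lam - ls) ^ 2)}

/-- The approximate centrality conditions with constants `C`, `γ`. -/
def central (C gam : ℝ) (z : Fin n → ℝ) (lam s : Fin m → ℝ) : Prop :=
  evnorm (P.Lz z lam) ≤ C * dmu lam s ∧
  evnorm (fun i => P.g i z + s i) ≤ C * dmu lam s ∧
  (∀ i, 0 < lam i) ∧ (∀ i, 0 < s i) ∧ (∀ i, gam * dmu lam s ≤ lam i * s i)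

/-- The active index set `B` at `z*`, as a type. -/
abbrev Bsub (zstar : Fin n → ℝ) : Type := {i : Fin m // P.g i zstar = 0}

/-- The inactive index set `N` at `z*`, as a type. -/
abbrev Nsub (zstar : Fin n → ℝ) : Type := {i : Fin m // ¬ P.g i zstar = 0}

/-- `∇g(z)`:  the `n × m` matrix whose columns are the constraint gradients. -/
def Gfull (z : Fin n → ℝ) : Matrix (Fin n) (Fin m) ℝ :=
  Matrix.of fun j i => P.gradg i z j

/-- `∇g_B(z)`:  the columns of `∇g(z)` indexed by the active set `B` at `z*`. -/
def GB (zstar z : Fin n → ℝ) : Matrix (Fin n) (P.Bsub zstar) ℝ :=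
  Matrix.of fun j b => P.gradg b.1 z j

/-- `∇g_N(z)`:  the columns of `∇g(z)` indexed by the inactive set `N` at `z*`. -/
def GN (zstar z : Fin n → ℝ) : Matrix (Fin n) (P.Nsub zstar) ℝ :=
  Matrix.of fun j b => P.gradg b.1 z j

/-- The diagonal matrix `D_B = Λ_B⁻¹ S_B`. -/
def DB (zstar : Fin n → ℝ) (lam s : Fin m → ℝ) :
    Matrix (P.Bsub zstar) (P.Bsub zstar) ℝ :=
  Matrix.diagonal fun b => s b.1 / lam b.1

/-- The diagonal matrix `D_N = Λ_N⁻¹ S_N`. -/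
def DN (zstar : Fin n → ℝ) (lam s : Fin m → ℝ) :
    Matrix (P.Nsub zstar) (P.Nsub zstar) ℝ :=
  Matrix.diagonal fun b => s b.1 / lam b.1

/-- The exact primal–dual step: the solution of the linear system (pdip.orig). -/
def exactStep (z : Fin n → ℝ) (lam s t : Fin m → ℝ) (dz : Fin n → ℝ)
    (dl ds : Fin m → ℝ) : Prop :=
  (∀ j, ((P.Lzz z lam).mulVec dz) j + ((P.Gfull z).mulVec dl) j = -(P.Lz z lam j)) ∧
  (∀ i, (((P.Gfull z)ᵀ).mulVec dz) i + ds i = -(P.g i z + s i)) ∧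
  (∀ i, s i * dl i + lam i * ds i = -(s i * lam i + t i))

end NLP

/-- Part (a) of Assumption A: `z*` is a solution at which MFCQ, the second-order
condition, and strict complementarity hold, and the current iterate `(z,λ,s)`
satisfies the approximate centrality conditions with constants `C`, `γ`. -/
def AssumptionAa {n m : ℕ} (P : NLP n m) (zstar : Fin n → ℝ) (C gam : ℝ)
    (z : Fin n → ℝ) (lam s : Fin m → ℝ) : Prop :=
  P.isSolution zstar ∧ P.MFCQ zstar ∧ P.SOC zstar ∧ P.StrictComp zstar ∧
  P.central C gam z lam s

/-- The data of a singular value decomposition `∇g_B(z*) = Û Σ Uᵀ`, where the square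
matrices `[Û V̂]` (of order `n`) and `[U V]` (of order `|B|`) are orthogonal and `Σ` is
diagonal with positive diagonal entries. -/
structure SVDdata {n m : ℕ} (P : NLP n m) (zstar : Fin n → ℝ) where
  k : ℕ
  kc : ℕ
  r : ℕ
  Uhat : Matrix (Fin n) (Fin k) ℝ
  Vhat : Matrix (Fin n) (Fin kc) ℝ
  U : Matrix (P.Bsub zstar) (Fin k) ℝ
  V : Matrix (P.Bsub zstar) (Fin r) ℝ
  sig : Fin k → ℝ
  sig_pos : ∀ j, 0 < sig j
  hUhat : Uhatᵀ * Uhat = 1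
  hVhat : Vhatᵀ * Vhat = 1
  hUVhat : Uhatᵀ * Vhat = 0
  hhat_complete : Uhat * Uhatᵀ + Vhat * Vhatᵀ = 1
  hU : Uᵀ * U = 1
  hV : Vᵀ * V = 1
  hUV : Uᵀ * V = 0
  h_complete : U * Uᵀ + V * Vᵀ = 1
  hsvd : P.GB zstar zstar = Uhat * Matrix.diagonal sig * Uᵀ

section EuclideanNorm

variable {ι κ : Type*} [Fintype ι] [Fintype κ]

theorem evnorm_eq_norm (v : ι → ℝ) : evnorm v = ‖WithLp.toLp 2 v‖ := by
  simp [evnorm, EuclideanSpace.norm_eq]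

theorem evnorm_nonneg (v : ι → ℝ) : 0 ≤ evnorm v := Real.sqrt_nonneg _

theorem evnorm_add_le (v w : ι → ℝ) : evnorm (v + w) ≤ evnorm v + evnorm w := by
  simp only [evnorm_eq_norm, WithLp.toLp_add]
  exact norm_add_le _ _

theorem evnorm_sub_le (v w : ι → ℝ) : evnorm (v - w) ≤ evnorm v + evnorm w := by
  simp only [evnorm_eq_norm, WithLp.toLp_sub]
  exact norm_sub_le _ _

theorem evnorm_smul (a : ℝ) (v : ι → ℝ) : evnorm (a • v) = |a| * evnorm v := by
  simp only [evnorm_eq_norm, WithLp.toLp_smul, norm_smul, Real.norm_eq_abs]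

theorem evnorm_sq (v : ι → ℝ) : evnorm v ^ 2 = v ⬝ᵥ v := by
  rw [evnorm, Real.sq_sqrt (Finset.sum_nonneg fun _ _ => sq_nonneg _)]
  simp [dotProduct, sq]

theorem dotProduct_le_evnorm_mul (v w : ι → ℝ) : v ⬝ᵥ w ≤ evnorm v * evnorm w :=
  Real.sum_mul_le_sqrt_mul_sqrt _ _ _

theorem abs_apply_le_evnorm (v : ι → ℝ) (i : ι) : |v i| ≤ evnorm v :=
  Real.abs_le_sqrt (Finset.single_le_sum (f := fun i => v i ^ 2)
    (fun _ _ => sq_nonneg _) (Finset.mem_univ i))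

theorem norm_le_evnorm (v : ι → ℝ) : ‖v‖ ≤ evnorm v :=
  (pi_norm_le_iff_of_nonneg (evnorm_nonneg v)).2 (abs_apply_le_evnorm v)

theorem evnorm_le_card_mul_norm (v : ι → ℝ) : evnorm v ≤ Fintype.card ι * ‖v‖ := by
  refine Real.sqrt_le_iff.2 ⟨by positivity, ?_⟩
  calc ∑ i, v i ^ 2 ≤ ∑ _ : ι, ‖v‖ ^ 2 :=
        Finset.sum_le_sum fun i _ => by
          rw [← sq_abs (v i)]
          exact pow_le_pow_left₀ (abs_nonneg _) (norm_le_pi_norm v i) 2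
    _ = Fintype.card ι * ‖v‖ ^ 2 := by simp
    _ ≤ (Fintype.card ι * ‖v‖) ^ 2 := by
        rw [mul_pow]
        gcongr
        exact_mod_cast Nat.le_self_pow two_ne_zero _

theorem continuous_evnorm : Continuous (evnorm : (ι → ℝ) → ℝ) := by
  unfold evnorm
  fun_prop

theorem mnorm_eq_evnorm (M : Matrix ι κ ℝ) :
    mnorm M = evnorm fun p : ι × κ => M p.1 p.2 := by
  rw [mnorm, evnorm, Fintype.sum_prod_type]

theorem mnorm_nonneg (M : Matrix ι κ ℝ) : 0 ≤ mnorm M := Real.sqrt_nonneg _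

theorem mnorm_add_le (M N : Matrix ι κ ℝ) : mnorm (M + N) ≤ mnorm M + mnorm N := by
  simp only [mnorm_eq_evnorm]
  exact evnorm_add_le _ _

theorem mnorm_smul (a : ℝ) (M : Matrix ι κ ℝ) : mnorm (a • M) = |a| * mnorm M := by
  simp only [mnorm_eq_evnorm, ← evnorm_smul]
  rfl

theorem mnorm_sum_le {τ : Type*} (s : Finset τ) (f : τ → Matrix ι κ ℝ) :
    mnorm (∑ i ∈ s, f i) ≤ ∑ i ∈ s, mnorm (f i) :=
  Finset.le_sum_of_subadditive _ (by simp [mnorm]) mnorm_add_le s f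

theorem mnorm_transpose (M : Matrix ι κ ℝ) : mnorm Mᵀ = mnorm M := by
  simp only [mnorm, transpose_apply]
  rw [Finset.sum_comm]

theorem mnorm_le_sum_evnorm_col (M : Matrix ι κ ℝ) :
    mnorm M ≤ ∑ j, evnorm fun i => M i j := by
  rw [← mnorm_transpose]
  refine Real.sqrt_le_iff.2 ⟨Finset.sum_nonneg fun _ _ => evnorm_nonneg _, ?_⟩
  have h (j : κ) : ∑ i, Mᵀ j i ^ 2 = (evnorm fun i => M i j) ^ 2 := by
    rw [evnorm, Real.sq_sqrt (Finset.sum_nonneg fun _ _ => sq_nonneg _)]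
    rfl
  simp only [h]
  exact Finset.sum_sq_le_sq_sum_of_nonneg fun _ _ => evnorm_nonneg _

theorem evnorm_mulVec_le (M : Matrix ι κ ℝ) (v : κ → ℝ) :
    evnorm (M *ᵥ v) ≤ mnorm M * evnorm v := by
  rw [evnorm, mnorm, evnorm, ← Real.sqrt_mul (by positivity), Finset.sum_mul]
  exact Real.sqrt_le_sqrt (Finset.sum_le_sum fun i _ => Finset.sum_mul_sq_le_sq_mul_sq _ _ _)

theorem evnorm_diagonal_mulVec_le [DecidableEq ι] {d : ι → ℝ} {t : ℝ} (ht : 0 ≤ t)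
    (hd : ∀ i, |d i| ≤ t) (v : ι → ℝ) : evnorm (diagonal d *ᵥ v) ≤ t * evnorm v := by
  rw [← abs_of_nonneg ht, ← evnorm_smul]
  refine Real.sqrt_le_sqrt (Finset.sum_le_sum fun i _ => ?_)
  rw [mulVec_diagonal, Pi.smul_apply, smul_eq_mul, mul_pow, mul_pow]
  gcongr ?_ * _
  exact sq_le_sq.2 (by simpa [abs_of_nonneg ht] using hd i)

theorem le_evnorm_diagonal_mulVec [DecidableEq ι] {d : ι → ℝ} {t : ℝ} (ht : 0 ≤ t)
    (hd : ∀ i, t ≤ d i) (v : ι → ℝ) : t * evnorm v ≤ evnorm (diagonal d *ᵥ v) := by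
  conv_lhs => rw [← abs_of_nonneg ht, ← evnorm_smul]
  refine Real.sqrt_le_sqrt (Finset.sum_le_sum fun i _ => ?_)
  rw [mulVec_diagonal, Pi.smul_apply, smul_eq_mul, mul_pow, mul_pow]
  gcongr
  exact hd i

theorem le_dotProduct_diagonal_mulVec [DecidableEq ι] {d : ι → ℝ} {t : ℝ}
    (hd : ∀ i, t ≤ d i) (v : ι → ℝ) : t * evnorm v ^ 2 ≤ v ⬝ᵥ diagonal d *ᵥ v := by
  rw [evnorm_sq, dotProduct, dotProduct, Finset.mul_sum]
  refine Finset.sum_le_sum fun i _ => ?_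
  rw [mulVec_diagonal]
  nlinarith [mul_le_mul_of_nonneg_right (hd i) (mul_self_nonneg (v i))]

variable [DecidableEq κ]

theorem evnorm_mulVec_of_transpose_mul_self {Q : Matrix ι κ ℝ} (hQ : Qᵀ * Q = 1)
    (v : κ → ℝ) : evnorm (Q *ᵥ v) = evnorm v := by
  refine (pow_left_inj₀ (evnorm_nonneg _) (evnorm_nonneg _) two_ne_zero).1 ?_
  rw [evnorm_sq, evnorm_sq, dotProduct_mulVec, ← mulVec_transpose, mulVec_mulVec, hQ,
    one_mulVec]

theorem evnorm_transpose_mulVec_le {Q : Matrix ι κ ℝ} (hQ : Qᵀ * Q = 1) (v : ι → ℝ) :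
    evnorm (Qᵀ *ᵥ v) ≤ evnorm v := by
  have h : evnorm (Qᵀ *ᵥ v) * evnorm (Qᵀ *ᵥ v) ≤ evnorm v * evnorm (Qᵀ *ᵥ v) := by
    calc evnorm (Qᵀ *ᵥ v) * evnorm (Qᵀ *ᵥ v) = v ⬝ᵥ Q *ᵥ Qᵀ *ᵥ v := by
          rw [← sq, evnorm_sq, dotProduct_mulVec v, ← mulVec_transpose]
      _ ≤ evnorm v * evnorm (Q *ᵥ Qᵀ *ᵥ v) := dotProduct_le_evnorm_mul _ _
      _ = evnorm v * evnorm (Qᵀ *ᵥ v) := by rw [evnorm_mulVec_of_transpose_mul_self hQ]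
  rcases (evnorm_nonneg (Qᵀ *ᵥ v)).eq_or_lt with h0 | h0
  · rw [← h0]
    exact evnorm_nonneg v
  · exact le_of_mul_le_mul_right h h0

end EuclideanNorm

namespace SVDdata

variable {n m : ℕ} {P : NLP n m} {zstar : Fin n → ℝ} (SV : SVDdata P zstar)

theorem evnorm_primal_le (w : Fin n → ℝ) :
    evnorm w ≤ evnorm (SV.Uhatᵀ *ᵥ w) + evnorm (SV.Vhatᵀ *ᵥ w) := by
  have h : w = SV.Uhat *ᵥ SV.Uhatᵀ *ᵥ w + SV.Vhat *ᵥ SV.Vhatᵀ *ᵥ w := by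
    rw [mulVec_mulVec, mulVec_mulVec, ← add_mulVec, SV.hhat_complete, one_mulVec]
  calc evnorm w = evnorm (SV.Uhat *ᵥ SV.Uhatᵀ *ᵥ w + SV.Vhat *ᵥ SV.Vhatᵀ *ᵥ w) := by rw [← h]
    _ ≤ _ := evnorm_add_le _ _
    _ = _ := by
        rw [evnorm_mulVec_of_transpose_mul_self SV.hUhat,
          evnorm_mulVec_of_transpose_mul_self SV.hVhat]

theorem evnorm_dual_le (y : P.Bsub zstar → ℝ) :
    evnorm y ≤ evnorm (SV.Uᵀ *ᵥ y) + evnorm (SV.Vᵀ *ᵥ y) := by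
  have h : y = SV.U *ᵥ SV.Uᵀ *ᵥ y + SV.V *ᵥ SV.Vᵀ *ᵥ y := by
    rw [mulVec_mulVec, mulVec_mulVec, ← add_mulVec, SV.h_complete, one_mulVec]
  calc evnorm y = evnorm (SV.U *ᵥ SV.Uᵀ *ᵥ y + SV.V *ᵥ SV.Vᵀ *ᵥ y) := by rw [← h]
    _ ≤ _ := evnorm_add_le _ _
    _ = _ := by
        rw [evnorm_mulVec_of_transpose_mul_self SV.hU,
          evnorm_mulVec_of_transpose_mul_self SV.hV]

theorem GB_mul_V : P.GB zstar zstar * SV.V = 0 := by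
  rw [SV.hsvd, Matrix.mul_assoc, SV.hUV, Matrix.mul_zero]

theorem Vhat_transpose_mul_GB : SV.Vhatᵀ * P.GB zstar zstar = 0 := by
  have h : SV.Vhatᵀ * SV.Uhat = 0 := by
    simpa using congrArg transpose SV.hUVhat
  rw [SV.hsvd, ← Matrix.mul_assoc, ← Matrix.mul_assoc, h, Matrix.zero_mul, Matrix.zero_mul]

theorem Uhat_transpose_mul_GB :
    SV.Uhatᵀ * P.GB zstar zstar = diagonal SV.sig * SV.Uᵀ := by
  rw [SV.hsvd, ← Matrix.mul_assoc, ← Matrix.mul_assoc, SV.hUhat, Matrix.one_mul]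

theorem U_transpose_mul_GB_transpose :
    SV.Uᵀ * (P.GB zstar zstar)ᵀ = diagonal SV.sig * SV.Uhatᵀ := by
  rw [SV.hsvd, transpose_mul, transpose_mul, transpose_transpose, diagonal_transpose,
    ← Matrix.mul_assoc, SV.hU, Matrix.one_mul]

theorem exists_pos_le_sig : ∃ s : ℝ, 0 < s ∧ ∀ j, s ≤ SV.sig j := by
  rcases isEmpty_or_nonempty (Fin SV.k) with _ | _
  · exact ⟨1, one_pos, fun j => isEmptyElim j⟩
  · obtain ⟨j, hj⟩ := Finite.exists_min SV.sig
    exact ⟨SV.sig j, SV.sig_pos j, hj⟩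

variable {L : Matrix (Fin n) (Fin n) ℝ} {dB : P.Bsub zstar → ℝ} {w r1 r3 e1 : Fin n → ℝ}
  {y r4 e2 : P.Bsub zstar → ℝ} {s t T : ℝ}

theorem evnorm_V_le (ht : ∀ b, t ≤ dB b) (hT0 : 0 ≤ T) (hT : ∀ b, |dB b| ≤ T)
    (h2 : (P.GB zstar zstar)ᵀ *ᵥ w - diagonal dB *ᵥ y + e2 = (P.GB zstar zstar)ᵀ *ᵥ r3 + r4) :
    t * evnorm (SV.Vᵀ *ᵥ y) ≤ T * evnorm (SV.Uᵀ *ᵥ y) + evnorm e2 + evnorm r4 := by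
  set p := SV.U *ᵥ SV.Uᵀ *ᵥ y
  set q := SV.V *ᵥ SV.Vᵀ *ᵥ y with hq
  have hy : y = p + q := by
    simp only [p, q]
    rw [mulVec_mulVec, mulVec_mulVec, ← add_mulVec, SV.h_complete, one_mulVec]
  have hqn : evnorm q = evnorm (SV.Vᵀ *ᵥ y) := evnorm_mulVec_of_transpose_mul_self SV.hV _
  have hpn : evnorm p = evnorm (SV.Uᵀ *ᵥ y) := evnorm_mulVec_of_transpose_mul_self SV.hU _
  have hG (x : Fin n → ℝ) : q ⬝ᵥ (P.GB zstar zstar)ᵀ *ᵥ x = 0 := by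
    rw [dotProduct_mulVec, ← mulVec_transpose, transpose_transpose, hq, mulVec_mulVec,
      SV.GB_mul_V, zero_mulVec, zero_dotProduct]
  have hD : q ⬝ᵥ diagonal dB *ᵥ q = q ⬝ᵥ (e2 - r4 - diagonal dB *ᵥ p) := by
    have h3 := congrArg (q ⬝ᵥ ·) h2
    simp only [dotProduct_add, dotProduct_sub, hG] at h3
    rw [hy, mulVec_add, dotProduct_add] at h3
    rw [dotProduct_sub, dotProduct_sub]
    linarith
  have hle : t * evnorm q ^ 2 ≤ evnorm q * (T * evnorm p + evnorm e2 + evnorm r4) := by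
    calc t * evnorm q ^ 2 ≤ q ⬝ᵥ diagonal dB *ᵥ q := le_dotProduct_diagonal_mulVec ht q
      _ ≤ evnorm q * evnorm (e2 - r4 - diagonal dB *ᵥ p) := hD ▸ dotProduct_le_evnorm_mul _ _
      _ ≤ evnorm q * (T * evnorm p + evnorm e2 + evnorm r4) := by
          gcongr
          · exact evnorm_nonneg q
          · linarith [evnorm_sub_le (e2 - r4) (diagonal dB *ᵥ p), evnorm_sub_le e2 r4,
              evnorm_diagonal_mulVec_le hT0 hT p]
  rw [← hqn, ← hpn]
  rcases (evnorm_nonneg q).eq_or_lt with h0 | h0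
  · rw [← h0, mul_zero]
    linarith [mul_nonneg hT0 (evnorm_nonneg p), evnorm_nonneg e2, evnorm_nonneg r4]
  · refine le_of_mul_le_mul_left ?_ h0
    linarith

theorem evnorm_Uhat_le (hs0 : 0 ≤ s) (hs : ∀ j, s ≤ SV.sig j) (hT0 : 0 ≤ T)
    (hT : ∀ b, |dB b| ≤ T)
    (h2 : (P.GB zstar zstar)ᵀ *ᵥ w - diagonal dB *ᵥ y + e2 = (P.GB zstar zstar)ᵀ *ᵥ r3 + r4) :
    s * evnorm (SV.Uhatᵀ *ᵥ w) ≤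
      s * evnorm r3 + evnorm r4 + T * evnorm y + evnorm e2 := by
  have h3 : diagonal SV.sig *ᵥ SV.Uhatᵀ *ᵥ (w - r3) =
      SV.Uᵀ *ᵥ (r4 + diagonal dB *ᵥ y - e2) := by
    rw [mulVec_mulVec, ← SV.U_transpose_mul_GB_transpose, ← mulVec_mulVec, mulVec_sub]
    congr 1
    linear_combination h2
  have h4 := le_evnorm_diagonal_mulVec hs0 hs (SV.Uhatᵀ *ᵥ (w - r3))
  rw [h3] at h4
  have h5 := evnorm_add_le (SV.Uhatᵀ *ᵥ (w - r3)) (SV.Uhatᵀ *ᵥ r3)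
  rw [← mulVec_add, sub_add_cancel] at h5
  have h6 := mul_le_mul_of_nonneg_left
    (h5.trans (add_le_add_right (evnorm_transpose_mulVec_le SV.hUhat r3) _)) hs0
  linarith [evnorm_transpose_mulVec_le SV.hU (r4 + diagonal dB *ᵥ y - e2),
    evnorm_sub_le (r4 + diagonal dB *ᵥ y) e2, evnorm_add_le r4 (diagonal dB *ᵥ y),
    evnorm_diagonal_mulVec_le hT0 hT y]

theorem evnorm_Vhat_le
    (hs : ∀ x, s * evnorm x ≤ evnorm ((SV.Vhatᵀ * L * SV.Vhat) *ᵥ x))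
    (h1 : L *ᵥ w + P.GB zstar zstar *ᵥ y + e1 = r1) :
    s * evnorm (SV.Vhatᵀ *ᵥ w) ≤
      evnorm r1 + mnorm L * evnorm (SV.Uhatᵀ *ᵥ w) + evnorm e1 := by
  have hw : w = SV.Uhat *ᵥ SV.Uhatᵀ *ᵥ w + SV.Vhat *ᵥ SV.Vhatᵀ *ᵥ w := by
    rw [mulVec_mulVec, mulVec_mulVec, ← add_mulVec, SV.hhat_complete, one_mulVec]
  have h3 : (SV.Vhatᵀ * L * SV.Vhat) *ᵥ SV.Vhatᵀ *ᵥ w =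
      SV.Vhatᵀ *ᵥ (r1 - L *ᵥ SV.Uhat *ᵥ SV.Uhatᵀ *ᵥ w - e1) := by
    have h4 : r1 - L *ᵥ SV.Uhat *ᵥ SV.Uhatᵀ *ᵥ w - e1 =
        L *ᵥ SV.Vhat *ᵥ SV.Vhatᵀ *ᵥ w + P.GB zstar zstar *ᵥ y := by
      have h5 := congrArg (L *ᵥ ·) hw
      simp only [mulVec_add] at h5
      linear_combination h5 - h1
    rw [h4, mulVec_add, mulVec_mulVec y, SV.Vhat_transpose_mul_GB, zero_mulVec, add_zero,
      ← mulVec_mulVec, ← mulVec_mulVec]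
  have h4 := hs (SV.Vhatᵀ *ᵥ w)
  rw [h3] at h4
  have h5 := evnorm_mulVec_le L (SV.Uhat *ᵥ SV.Uhatᵀ *ᵥ w)
  rw [evnorm_mulVec_of_transpose_mul_self SV.hUhat] at h5
  linarith [evnorm_transpose_mulVec_le SV.hVhat (r1 - L *ᵥ SV.Uhat *ᵥ SV.Uhatᵀ *ᵥ w - e1),
    evnorm_sub_le (r1 - L *ᵥ SV.Uhat *ᵥ SV.Uhatᵀ *ᵥ w) e1,
    evnorm_sub_le r1 (L *ᵥ SV.Uhat *ᵥ SV.Uhatᵀ *ᵥ w)]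

theorem evnorm_U_le (hs0 : 0 ≤ s) (hs : ∀ j, s ≤ SV.sig j)
    (h1 : L *ᵥ w + P.GB zstar zstar *ᵥ y + e1 = r1) :
    s * evnorm (SV.Uᵀ *ᵥ y) ≤ evnorm r1 + mnorm L * evnorm w + evnorm e1 := by
  have h3 : diagonal SV.sig *ᵥ SV.Uᵀ *ᵥ y = SV.Uhatᵀ *ᵥ (r1 - L *ᵥ w - e1) := by
    rw [mulVec_mulVec, ← SV.Uhat_transpose_mul_GB, ← mulVec_mulVec]
    congr 1
    linear_combination h1
  have h4 := le_evnorm_diagonal_mulVec hs0 hs (SV.Uᵀ *ᵥ y)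
  rw [h3] at h4
  linarith [evnorm_transpose_mulVec_le SV.hUhat (r1 - L *ᵥ w - e1),
    evnorm_sub_le (r1 - L *ᵥ w) e1, evnorm_sub_le r1 (L *ᵥ w), evnorm_mulVec_le L w]

end SVDdata

theorem exists_absorbed_bounds {K : ℝ} (hK : 1 ≤ K) :
    ∃ eps : ℝ, 0 < eps ∧ eps ≤ 1 ∧ ∃ C : ℝ, 0 < C ∧
      ∀ mu u rho a b p q R1 R3 R4 : ℝ, 0 < mu → 0 ≤ a → 0 ≤ b → 0 ≤ p → 0 ≤ q →
        0 ≤ R1 → 0 ≤ R3 → 0 ≤ R4 → mu ≤ eps → u ≤ eps * mu → rho ≤ 2 * eps →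
        mu * q ≤ K * (mu * p + mu * (a + b) + u * (p + q) + R4) →
        a ≤ K * (R3 + R4 + mu * (a + b + p + q)) →
        b ≤ K * (R1 + a + rho * (a + b) + mu * (p + q)) →
        p ≤ K * (R1 + (a + b) + mu * (p + q)) →
        p + b + a ≤ C * (R1 + R3 + R4) ∧ q ≤ C * (R1 + R3 + R4 / mu) := by
  have hK0 : 0 < K := by linarith
  have hK2 : K ≤ K ^ 2 := by nlinarith
  have hK3 : K ^ 2 ≤ K ^ 3 := by nlinarith [sq_nonneg K]
  have hK4 : K ^ 3 ≤ K ^ 4 := by nlinarith [pow_pos hK0 3]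
  have hK5 : K ^ 4 ≤ K ^ 5 := by nlinarith [pow_pos hK0 4]
  refine ⟨1 / (148 * K ^ 4), by positivity, ?_, 225 * K ^ 5, by positivity, ?_⟩
  · rw [div_le_one (by positivity)]
    linarith
  intro mu u rho a b p q R1 R3 R4 hmu ha hb hp hq hR1 hR3 hR4 hmue hu hrho h1 h2 h3 h4
  set eps := 1 / (148 * K ^ 4) with heps
  have heps0 : 0 < eps := by positivity
  have hepsK : 148 * K ^ 4 * eps = 1 := by
    rw [heps]
    field_simp
  have hKeps : K * eps ≤ 1 / 2 := by nlinarith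
  set T := a + b + p with hT
  set R := R1 + R3 + R4 with hR
  set X := R + 2 * eps * T with hX
  have hT0 : 0 ≤ T := by positivity
  have hR0 : 0 ≤ R := by positivity
  have hmuT : mu * T ≤ 2 * eps * T := by nlinarith
  have hX0 : 0 ≤ X := by positivity
  have hRX : R ≤ X := by nlinarith
  have hq1 : mu * q ≤ 3 * K * (mu * T + R4) := by
    have hupq : K * (u * (p + q)) ≤ 1 / 2 * (mu * (p + q)) := by
      calc K * (u * (p + q)) ≤ K * (eps * mu * (p + q)) := by gcongr
        _ = K * eps * (mu * (p + q)) := by ring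
        _ ≤ 1 / 2 * (mu * (p + q)) := by gcongr
    have h5 : mu * p ≤ K * (mu * p) := le_mul_of_one_le_left (by positivity) hK
    have h6 : 0 ≤ K * (mu * a) := by positivity
    have h7 : 0 ≤ K * (mu * b) := by positivity
    have h8 : 0 ≤ K * R4 := by positivity
    rw [hT]
    linarith
  have hTq : mu * (T + q) ≤ 4 * K * X := by
    have h5 : mu * T ≤ K * (mu * T) := le_mul_of_one_le_left (by positivity) hK
    have h6 : K * (mu * T + R4) ≤ K * X := by
      gcongr
      linarith
    have h7 : 0 ≤ K * R4 := by positivity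
    linarith
  have hKX : K * X ≤ K ^ 2 * X := by gcongr
  have hKX3 : K ^ 2 * X ≤ K ^ 3 * X := by gcongr
  have hKX4 : K ^ 3 * X ≤ K ^ 4 * X := by gcongr
  have hXK : X ≤ K * X := le_mul_of_one_le_left hX0 hK
  have hpq : mu * (p + q) ≤ 4 * K * X := by
    have h5 : 0 ≤ mu * (a + b) := by positivity
    rw [hT] at hTq
    linarith
  have hae : a ≤ 5 * K ^ 2 * X := by
    calc a ≤ K * (R3 + R4 + mu * (a + b + p + q)) := h2
      _ ≤ K * (5 * K * X) := by
          gcongr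
          rw [hT] at hTq
          linarith
      _ = 5 * K ^ 2 * X := by ring
  have hbe : b ≤ 11 * K ^ 3 * X := by
    have h5 : rho * (a + b) ≤ X := by
      calc rho * (a + b) ≤ 2 * eps * T := by gcongr; linarith
        _ ≤ X := by linarith
    calc b ≤ K * (R1 + a + rho * (a + b) + mu * (p + q)) := h3
      _ ≤ K * (11 * K ^ 2 * X) := by
          gcongr
          linarith
      _ = 11 * K ^ 3 * X := by ring
  have hpe : p ≤ 21 * K ^ 4 * X := by
    calc p ≤ K * (R1 + (a + b) + mu * (p + q)) := h4
      _ ≤ K * (21 * K ^ 3 * X) := by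
          gcongr
          linarith
      _ = 21 * K ^ 4 * X := by ring
  have hTe : T ≤ 74 * K ^ 4 * R := by
    have h5 : 37 * K ^ 4 * X = 37 * K ^ 4 * R + 1 / 2 * T := by
      rw [hX]
      linear_combination (1 / 2 * T) * hepsK
    have h6 : T ≤ 37 * K ^ 4 * X := by
      rw [hT]
      linarith
    linarith
  refine ⟨?_, ?_⟩
  · have h5 : K ^ 4 * R ≤ K ^ 5 * R := by gcongr
    have h6 : 0 ≤ K ^ 5 * R := by positivity
    rw [hT] at hTe
    linarith
  · have hmu1 : mu ≤ 1 := by nlinarith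
    have hR4mu : R4 ≤ R4 / mu := le_div_self hR4 hmu hmu1
    have h5 : q ≤ 3 * K * (T + R4 / mu) := by
      refine le_of_mul_le_mul_left (hq1.trans_eq ?_) hmu
      field_simp
    calc q ≤ 3 * K * (T + R4 / mu) := h5
      _ ≤ 3 * K * (74 * K ^ 4 * (R1 + R3 + R4 / mu) + K ^ 4 * (R1 + R3 + R4 / mu)) := by
          refine mul_le_mul_of_nonneg_left (add_le_add (hTe.trans ?_) ?_) (by positivity)
          · exact mul_le_mul_of_nonneg_left (by linarith) (by positivity)
          · have h6 : R1 + R3 + R4 / mu ≤ K ^ 4 * (R1 + R3 + R4 / mu) :=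
              le_mul_of_one_le_left (by positivity) (by linarith)
            linarith
      _ = 225 * K ^ 5 * (R1 + R3 + R4 / mu) := by ring

theorem exists_rescaled_bounds {K : ℝ} (hK1 : 1 ≤ K) :
    ∃ eps : ℝ, 0 < eps ∧ eps ≤ 1 ∧ ∃ C : ℝ, 0 < C ∧
      ∀ c s h mu u a b p q R1 R3 R4 nL nw ny n1 n2 : ℝ,
        0 < c → c ≤ K → 0 < s → s⁻¹ ≤ K → 0 < h → h⁻¹ ≤ K → 0 < mu → 0 < u →
        mu ≤ eps → u / mu ≤ eps → 0 ≤ a → 0 ≤ b → 0 ≤ p → 0 ≤ q → 0 ≤ R1 → 0 ≤ R3 → 0 ≤ R4 →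
        0 ≤ nw → 0 ≤ ny → nL ≤ K → nw ≤ a + b → ny ≤ p + q →
        n1 ≤ K * ((u / mu + mu) * nw + mu * ny) → n2 ≤ K * (mu * nw + u * ny) →
        c⁻¹ * mu * q ≤ c * mu * p + n2 + R4 →
        s * a ≤ s * R3 + R4 + c * mu * ny + n2 →
        h * b ≤ R1 + nL * a + n1 →
        s * p ≤ R1 + nL * nw + n1 →
        p + b + a ≤ C * (R1 + R3 + R4) ∧ q ≤ C * (R1 + R3 + R4 / mu) := by
  have hK0 : 0 < K := by linarith
  have hK2 : 1 ≤ 3 * K ^ 2 := by nlinarith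
  obtain ⟨eps, heps, heps1, C, hC, hmain⟩ := exists_absorbed_bounds hK2
  refine ⟨eps, heps, heps1, C, hC, ?_⟩
  intro c s h mu u a b p q R1 R3 R4 nL nw ny n1 n2 hc0 hcK hs hsK hh hhK hmu hu hmu1 hum
    ha0 hb0 hp0 hq0 hr1 hr3 hr4 hw0 hy0 hL hwle hyle he1le he2le bV bUhat bVhat bU
  have hsi : 0 < s⁻¹ := inv_pos.2 hs
  have hu1 : u ≤ eps * mu := (div_le_iff₀ hmu).1 hum
  have hu2 : u ≤ mu := hu1.trans (mul_le_of_le_one_left hmu.le heps1)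
  have hKK : K ^ 2 ≤ 3 * K ^ 2 := by nlinarith
  have he1le' : n1 ≤ K * ((u / mu + mu) * (a + b) + mu * (p + q)) :=
    he1le.trans (by gcongr)
  have he2le' : n2 ≤ K * (mu * (a + b) + u * (p + q)) := he2le.trans (by gcongr)
  refine hmain mu u (u / mu + mu) a b p q _ _ _ hmu ha0 hb0 hp0 hq0 hr1 hr3 hr4 hmu1 hu1
    (by linarith) ?_ ?_ ?_ ?_
  · calc mu * q = c * (c⁻¹ * mu * q) := by field_simp
      _ ≤ K * (K * mu * p + K * (mu * (a + b) + u * (p + q)) + K * R4) := by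
          refine mul_le_mul hcK (bV.trans (add_le_add (add_le_add ?_ he2le') ?_))
            (by positivity) hK0.le
          · gcongr
          · exact le_mul_of_one_le_left hr4 hK1
      _ = K ^ 2 * (mu * p + mu * (a + b) + u * (p + q) + R4) := by ring
      _ ≤ _ := by
          gcongr
  · calc a = s⁻¹ * (s * a) := by field_simp
      _ ≤ s⁻¹ * (s * R3 + R4 + K * (mu * (p + q)) +
            K * (mu * (a + b) + mu * (p + q))) := by
          refine mul_le_mul_of_nonneg_left (bUhat.trans ?_) hsi.le
          refine add_le_add (add_le_add le_rfl ?_) (he2le'.trans ?_)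
          · rw [← mul_assoc]
            gcongr
          · gcongr
      _ = R3 + s⁻¹ * (R4 + K * (mu * (p + q)) +
            K * (mu * (a + b) + mu * (p + q))) := by
          field_simp
          ring
      _ ≤ 3 * K ^ 2 * R3 + K * (3 * K * R4 + K * (mu * (p + q)) +
            K * (3 * (mu * (a + b)) + 2 * (mu * (p + q)))) := by
          refine add_le_add (le_mul_of_one_le_left hr3 (by nlinarith))
            (mul_le_mul (by linarith) ?_ (by positivity) hK0.le)
          refine add_le_add (add_le_add (le_mul_of_one_le_left hr4 (by linarith)) le_rfl) ?_
          have h3 : 0 ≤ mu * (a + b) := by positivity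
          have h4 : 0 ≤ mu * (p + q) := by positivity
          refine mul_le_mul_of_nonneg_left ?_ hK0.le
          linarith
      _ = _ := by ring
  · calc b = h⁻¹ * (h * b) := by field_simp
      _ ≤ K * (K * R1 + K * a + K * ((u / mu + mu) * (a + b) + mu * (p + q))) := by
          refine mul_le_mul (by linarith) (bVhat.trans ?_) (by positivity) hK0.le
          refine add_le_add (add_le_add (le_mul_of_one_le_left hr1 hK1) ?_) he1le'
          exact mul_le_mul_of_nonneg_right (hL) ha0
      _ = K ^ 2 * (R1 + a + (u / mu + mu) * (a + b) + mu * (p + q)) := by ring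
      _ ≤ _ := by
          gcongr
  · calc p = s⁻¹ * (s * p) := by field_simp
      _ ≤ K * (3 * K * R1 + K * (a + b) + K * (2 * (a + b) + 3 * (mu * (p + q)))) := by
          refine mul_le_mul (by linarith) (bU.trans ?_) (by positivity) hK0.le
          refine add_le_add (add_le_add (le_mul_of_one_le_left hr1 (by linarith)) ?_)
            (he1le'.trans ?_)
          · exact mul_le_mul (hL) hwle hw0 hK0.le
          · have h4 : 0 ≤ mu * (p + q) := by positivity
            have h5 : (u / mu + mu) * (a + b) ≤ 2 * (a + b) := by
              gcongr
              linarith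
            refine mul_le_mul_of_nonneg_left ?_ hK0.le
            linarith
      _ = _ := by ring

namespace NLP

variable {n m : ℕ} (P : NLP n m) {zstar : Fin n → ℝ}

theorem continuous_Lzz (z : Fin n → ℝ) : Continuous (P.Lzz z) := by
  unfold Lzz
  fun_prop

theorem continuous_Lz (z : Fin n → ℝ) : Continuous (P.Lz z) := by
  unfold Lz
  fun_prop

theorem isClosed_Slam : IsClosed (P.Slam zstar) := by
  have h : P.Slam zstar = {lam | P.Lz zstar lam = 0} ∩ ({_lam | ∀ i, P.g i zstar ≤ 0} ∩
      ({lam | ∀ i, 0 ≤ lam i} ∩ {lam | ∑ i, lam i * P.g i zstar = 0})) := rfl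
  rw [h]
  refine (isClosed_eq (P.continuous_Lz zstar) continuous_const).inter (isClosed_const.inter
    (IsClosed.inter ?_ (isClosed_eq (by fun_prop) continuous_const)))
  simp only [Set.ofPred_forall]
  exact isClosed_iInter fun i => isClosed_le continuous_const (by fun_prop)

theorem KKT.mul_g_eq_zero {P : NLP n m} {z : Fin n → ℝ} {lam : Fin m → ℝ} (h : P.KKT z lam)
    (i : Fin m) : lam i * P.g i z = 0 :=
  (Finset.sum_eq_zero_iff_of_nonpos fun j _ =>
    mul_nonpos_of_nonneg_of_nonpos (h.2.2.1 j) (h.2.1 j)).1 h.2.2.2 i (Finset.mem_univ i)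

variable {P} in
theorem MFCQ.exists_bound (h : P.MFCQ zstar) :
    ∃ M : ℝ, 0 ≤ M ∧ ∀ ls ∈ P.Slam zstar, ∀ i, |ls i| ≤ M := by
  obtain ⟨ybar, hy⟩ := h
  set A := ∑ j, P.gradphi zstar j * ybar j with hA
  set G : Fin m → ℝ := fun i => -∑ j, P.gradg i zstar j * ybar j with hG
  refine ⟨∑ i, |A / G i|, Finset.sum_nonneg fun i _ => abs_nonneg _, fun ls hls i => ?_⟩
  have hnn : ∀ k, 0 ≤ ls k * G k := fun k => by
    rcases mul_eq_zero.1 (KKT.mul_g_eq_zero hls k) with h0 | h0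
    · simp [h0]
    · exact mul_nonneg (hls.2.2.1 k) (neg_pos.2 (hy k h0)).le
  have hsum : ∑ k, ls k * G k = A := by
    have h1 : ∑ j, P.Lz zstar ls j * ybar j = 0 := by simp [hls.1]
    have h2 : ∑ j, P.Lz zstar ls j * ybar j = A - ∑ k, ls k * G k := by
      simp only [Lz, hG, add_mul, Finset.sum_add_distrib, Finset.sum_mul, Finset.mul_sum, mul_neg,
        Finset.sum_neg_distrib, sub_neg_eq_add, mul_assoc, A]
      rw [Finset.sum_comm]
    linarith
  rw [abs_of_nonneg (hls.2.2.1 i)]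
  refine le_trans ?_ (Finset.single_le_sum (f := fun i => |A / G i|)
    (fun k _ => abs_nonneg _) (Finset.mem_univ i))
  rcases mul_eq_zero.1 (KKT.mul_g_eq_zero hls i) with h0 | h0
  · simp [h0]
  · refine le_trans ?_ (le_abs_self _)
    rw [le_div_iff₀ (neg_pos.2 (hy i h0)), ← hsum]
    exact Finset.single_le_sum (f := fun k => ls k * G k) (fun k _ => hnn k) (Finset.mem_univ i)

variable {P} in
theorem MFCQ.isCompact_Slam (h : P.MFCQ zstar) : IsCompact (P.Slam zstar) := by
  obtain ⟨M, -, hM⟩ := h.exists_bound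
  exact isCompact_Icc.of_isClosed_subset P.isClosed_Slam fun ls hls =>
    ⟨fun i => (abs_le.1 (hM ls hls i)).1, fun i => (abs_le.1 (hM ls hls i)).2⟩

variable {P} in
theorem MFCQ.exists_uniform_lower_bound (h : P.MFCQ zstar) {k : ℕ}
    (W : Matrix (Fin n) (Fin k) ℝ)
    (hpos : ∀ ls ∈ P.Slam zstar, ∀ x : Fin k → ℝ, evnorm x = 1 →
      0 < evnorm ((Wᵀ * P.Lzz zstar ls * W) *ᵥ x)) :
    ∃ s : ℝ, 0 < s ∧ ∀ ls ∈ P.Slam zstar, ∀ x : Fin k → ℝ,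
      s * evnorm x ≤ evnorm ((Wᵀ * P.Lzz zstar ls * W) *ᵥ x) := by
  have hsphere : IsCompact {x : Fin k → ℝ | evnorm x = 1} :=
    (isCompact_closedBall (0 : Fin k → ℝ) 1).of_isClosed_subset
      (isClosed_eq continuous_evnorm continuous_const) fun x hx => by
        rw [mem_closedBall_zero_iff]
        exact (norm_le_evnorm x).trans_eq hx
  have hcont : Continuous fun q : (Fin m → ℝ) × (Fin k → ℝ) =>
      evnorm ((Wᵀ * P.Lzz zstar q.1 * W) *ᵥ q.2) :=
    continuous_evnorm.comp (((continuous_const.matrix_mul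
      ((P.continuous_Lzz zstar).comp continuous_fst)).matrix_mul
        continuous_const).matrix_mulVec continuous_snd)
  obtain ⟨s, hs, hle⟩ := (h.isCompact_Slam.prod hsphere).exists_forall_le' hcont.continuousOn
    (a := 0) fun q hq => hpos q.1 hq.1 q.2 hq.2
  refine ⟨s, hs, fun ls hls x => ?_⟩
  rcases (evnorm_nonneg x).eq_or_lt with h0 | h0
  · rw [← h0, mul_zero]
    exact evnorm_nonneg _
  · have h1 : evnorm ((evnorm x)⁻¹ • x) = 1 := by
      rw [evnorm_smul, abs_of_pos (inv_pos.2 h0), inv_mul_cancel₀ h0.ne']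
    have h2 := hle (ls, (evnorm x)⁻¹ • x) ⟨hls, h1⟩
    simp only [mulVec_smul] at h2
    rw [evnorm_smul, abs_of_pos (inv_pos.2 h0), inv_mul_eq_div, le_div_iff₀ h0] at h2
    exact h2

theorem exists_mem_Slam_near (hne : (P.Slam zstar).Nonempty) {z : Fin n → ℝ}
    {lam : Fin m → ℝ} {d : ℝ} (hd : P.delta zstar z lam < d) :
    ∃ ls ∈ P.Slam zstar, evnorm (z - zstar) ≤ d ∧ evnorm (lam - ls) ≤ d := by
  obtain ⟨ls₀, hls₀⟩ := hne
  obtain ⟨_, ⟨ls, hls, rfl⟩, hlt⟩ := exists_lt_of_csInf_lt (s := {d | ∃ ls ∈ P.Slam zstar,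
    d = Real.sqrt (evnorm (z - zstar) ^ 2 + evnorm (lam - ls) ^ 2)}) ⟨_, ls₀, hls₀, rfl⟩ hd
  refine ⟨ls, hls, le_trans (Real.le_sqrt_of_sq_le ?_) hlt.le,
    le_trans (Real.le_sqrt_of_sq_le ?_) hlt.le⟩
  · exact le_add_of_nonneg_right (sq_nonneg _)
  · exact le_add_of_nonneg_left (sq_nonneg _)

theorem exists_mnorm_Lzz_le (zstar : Fin n → ℝ) (M : ℝ) :
    ∃ K : ℝ, 0 ≤ K ∧ ∀ ls : Fin m → ℝ, (∀ i, |ls i| ≤ M) → mnorm (P.Lzz zstar ls) ≤ K := by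
  refine ⟨mnorm (P.hessphi zstar) + ∑ i, |M| * mnorm (P.hessg i zstar),
    add_nonneg (mnorm_nonneg _) (Finset.sum_nonneg fun i _ => mul_nonneg (abs_nonneg _)
      (mnorm_nonneg _)), fun ls hls => ?_⟩
  refine (mnorm_add_le _ _).trans (add_le_add_right ((mnorm_sum_le _ _).trans ?_) _)
  refine Finset.sum_le_sum fun i _ => ?_
  rw [mnorm_smul]
  exact mul_le_mul_of_nonneg_right ((hls i).trans (le_abs_self M)) (mnorm_nonneg _)

theorem exists_mnorm_Lzz_sub_le (zstar : Fin n → ℝ) (M : ℝ) :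
    ∃ K : ℝ, 0 ≤ K ∧ ∀ (z : Fin n → ℝ) (lam ls : Fin m → ℝ), (∀ i, |ls i| ≤ M) →
      ∀ d ≤ 1, evnorm (z - zstar) ≤ d → evnorm (lam - ls) ≤ d →
        mnorm (P.Lzz z lam - P.Lzz zstar ls) ≤ K * d := by
  obtain ⟨Kp, hKp⟩ := P.lip_phi
  choose Kg hKg using P.lip_g
  refine ⟨|Kp| + ∑ i, (|Kg i| + mnorm (P.hessg i zstar) + |M| * |Kg i|), ?_, ?_⟩
  · have h (i : Fin m) := mnorm_nonneg (P.hessg i zstar)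
    exact add_nonneg (abs_nonneg _) (Finset.sum_nonneg fun i _ => by have := h i; positivity)
  intro z lam ls hls d hd1 hz hlam
  have hd0 : 0 ≤ d := (evnorm_nonneg _).trans hz
  have hsplit : P.Lzz z lam - P.Lzz zstar ls = (P.hessphi z - P.hessphi zstar) +
      ∑ i, ((lam - ls) i • (P.hessg i z - P.hessg i zstar) + (lam - ls) i • P.hessg i zstar +
        ls i • (P.hessg i z - P.hessg i zstar)) := by
    have h (i : Fin m) : (lam - ls) i • (P.hessg i z - P.hessg i zstar) +
        (lam - ls) i • P.hessg i zstar + ls i • (P.hessg i z - P.hessg i zstar) =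
        lam i • P.hessg i z - ls i • P.hessg i zstar := by
      rw [Pi.sub_apply]
      module
    simp only [h, Finset.sum_sub_distrib, Lzz]
    abel
  rw [hsplit, add_mul, Finset.sum_mul]
  refine (mnorm_add_le _ _).trans (add_le_add ?_ ((mnorm_sum_le _ _).trans
    (Finset.sum_le_sum fun i _ => ?_)))
  · refine (hKp z zstar).trans ?_
    exact mul_le_mul (le_abs_self _) hz (evnorm_nonneg _) (abs_nonneg _)
  · have h1 : mnorm (P.hessg i z - P.hessg i zstar) ≤ |Kg i| * d :=
      (hKg i z zstar).trans (mul_le_mul (le_abs_self _) hz (evnorm_nonneg _) (abs_nonneg _))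
    have h2 : |(lam - ls) i| ≤ d := (abs_apply_le_evnorm _ i).trans hlam
    have h3 : |ls i| ≤ |M| := (hls i).trans (le_abs_self M)
    have h4 := mnorm_nonneg (P.hessg i z - P.hessg i zstar)
    have h5 := mnorm_nonneg (P.hessg i zstar)
    calc _ ≤ |(lam - ls) i| * mnorm (P.hessg i z - P.hessg i zstar) +
          |(lam - ls) i| * mnorm (P.hessg i zstar) +
          |ls i| * mnorm (P.hessg i z - P.hessg i zstar) := by
            simp only [← mnorm_smul]
            exact (mnorm_add_le _ _).trans (add_le_add_left (mnorm_add_le _ _) _)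
      _ ≤ 1 * (|Kg i| * d) + d * mnorm (P.hessg i zstar) + |M| * (|Kg i| * d) := by
            gcongr
            exact h2.trans hd1
      _ = _ := by ring

theorem exists_evnorm_gradg_sub_le (zstar : Fin n → ℝ) :
    ∃ r : ℝ, 0 < r ∧ ∃ K : ℝ, 0 ≤ K ∧ ∀ z : Fin n → ℝ, evnorm (z - zstar) ≤ r →
      ∀ i, evnorm (P.gradg i z - P.gradg i zstar) ≤ K * evnorm (z - zstar) := by
  have hO (i : Fin m) := (P.hess_g i zstar).isBigO_sub.bound
  choose A hA using hO
  obtain ⟨r, hr, hball⟩ := Metric.eventually_nhds_iff.1 (Filter.eventually_all.2 hA)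
  refine ⟨r / 2, half_pos hr, n * ∑ i, |A i|,
    mul_nonneg n.cast_nonneg (Finset.sum_nonneg fun i _ => abs_nonneg _), fun z hz i => ?_⟩
  have hd : dist z zstar < r := by
    rw [dist_eq_norm]
    linarith [norm_le_evnorm (z - zstar)]
  calc evnorm (P.gradg i z - P.gradg i zstar)
      ≤ n * ‖P.gradg i z - P.gradg i zstar‖ := by
        simpa using evnorm_le_card_mul_norm (P.gradg i z - P.gradg i zstar)
    _ ≤ n * (A i * ‖z - zstar‖) := by
        gcongr
        exact hball hd i
    _ ≤ n * ((∑ i, |A i|) * evnorm (z - zstar)) := by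
        refine mul_le_mul_of_nonneg_left (mul_le_mul ?_ (norm_le_evnorm _) (norm_nonneg _)
          (Finset.sum_nonneg fun i _ => abs_nonneg _)) n.cast_nonneg
        exact (le_abs_self _).trans (Finset.single_le_sum (f := fun i => |A i|)
          (fun k _ => abs_nonneg _) (Finset.mem_univ i))
    _ = _ := by ring

theorem exists_mnorm_gradg_bounds (zstar : Fin n → ℝ) :
    ∃ r : ℝ, 0 < r ∧ ∃ K : ℝ, 0 ≤ K ∧ ∀ z : Fin n → ℝ, evnorm (z - zstar) ≤ r →
      mnorm (P.GB zstar z - P.GB zstar zstar) ≤ K * evnorm (z - zstar) ∧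
      mnorm (P.GN zstar z) ≤ K := by
  obtain ⟨r, hr, K, hK, hle⟩ := P.exists_evnorm_gradg_sub_le zstar
  have hcol : 0 ≤ ∑ b : P.Nsub zstar, (evnorm (P.gradg b.1 zstar) + K * r) :=
    Finset.sum_nonneg fun b _ => add_nonneg (evnorm_nonneg _) (by positivity)
  refine ⟨r, hr, Fintype.card (P.Bsub zstar) * K +
    ∑ b : P.Nsub zstar, (evnorm (P.gradg b.1 zstar) + K * r), by positivity, fun z hz => ⟨?_, ?_⟩⟩
  · refine (mnorm_le_sum_evnorm_col _).trans ?_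
    calc _ ≤ ∑ _b : P.Bsub zstar, K * evnorm (z - zstar) :=
          Finset.sum_le_sum fun b _ => hle z hz b.1
      _ = Fintype.card (P.Bsub zstar) * K * evnorm (z - zstar) := by
          simp [mul_assoc]
      _ ≤ _ := by
          gcongr
          · exact evnorm_nonneg _
          · linarith
  · refine (mnorm_le_sum_evnorm_col _).trans ((Finset.sum_le_sum fun b _ => ?_).trans
      (le_add_of_nonneg_left (by positivity)))
    calc evnorm (P.gradg b.1 z)
        = evnorm (P.gradg b.1 zstar + (P.gradg b.1 z - P.gradg b.1 zstar)) := by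
          rw [add_sub_cancel]
      _ ≤ evnorm (P.gradg b.1 zstar) + K * evnorm (z - zstar) :=
          (evnorm_add_le _ _).trans (add_le_add_right (hle z hz b.1) _)
      _ ≤ _ := by gcongr

end NLP

theorem sigmaMin_le {ι κ : Type*} [Fintype ι] [Fintype κ] (M : Matrix ι κ ℝ) {x : κ → ℝ}
    (hx : evnorm x = 1) : sigmaMin M ≤ evnorm (M *ᵥ x) := by
  refine csInf_le ⟨0, ?_⟩ ⟨x, hx, rfl⟩
  rintro _ ⟨x, -, rfl⟩
  exact evnorm_nonneg _

namespace NLP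

variable {n m : ℕ} (P : NLP n m) {zstar z : Fin n → ℝ} {lam ls : Fin m → ℝ}
  {c kap mu u KH KG K : ℝ} {dN : P.Nsub zstar → ℝ} {dB : P.Bsub zstar → ℝ}
  {E11 : Matrix (Fin n) (Fin n) ℝ} {E12 : Matrix (Fin n) (P.Bsub zstar) ℝ}
  {E21 : Matrix (P.Bsub zstar) (Fin n) ℝ} {E22 : Matrix (P.Bsub zstar) (P.Bsub zstar) ℝ}
  {w r1 r3 : Fin n → ℝ} {y r4 : P.Bsub zstar → ℝ}

theorem evnorm_primal_residual_le (hmu : 0 < mu) (hu : 0 < u) (hu2 : u ≤ mu) (hc0 : 0 < c)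
    (hkap : 0 < kap) (hKH0 : 0 ≤ KH) (hKG0 : 0 ≤ KG)
    (hK1 : KH * (c + 1) + KG * (c * KG) + kap ≤ K) (hK2 : KG * (c + 1) + kap ≤ K)
    (hLdiff : mnorm (P.Lzz z lam - P.Lzz zstar ls) ≤ KH * ((c + 1) * mu))
    (hGN : mnorm (P.GN zstar z) ≤ KG)
    (hGBmu : mnorm (P.GB zstar z - P.GB zstar zstar) ≤ KG * (c + 1) * mu)
    (hdNinv : ∀ b, |(dN b)⁻¹| ≤ c * mu)
    (hE11 : mnorm E11 ≤ kap * (u / mu + mu)) (hE12 : mnorm E12 ≤ kap * u)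
    (heq1 : ∀ j, ((P.Lzz z lam +
      P.GN zstar z * diagonal (fun b => (dN b)⁻¹) * (P.GN zstar z)ᵀ + E11) *ᵥ w) j +
        ((P.GB zstar z + E12) *ᵥ y) j = r1 j) :
    evnorm (r1 - P.Lzz zstar ls *ᵥ w - P.GB zstar zstar *ᵥ y) ≤
      K * ((u / mu + mu) * evnorm w + mu * evnorm y) := by
  set L := P.Lzz zstar ls
  set e1 := r1 - L *ᵥ w - P.GB zstar zstar *ᵥ y with he1
  have hw0 := evnorm_nonneg w
  have hy0 := evnorm_nonneg y
  have he1' : e1 = (P.Lzz z lam - L) *ᵥ w +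
      P.GN zstar z *ᵥ diagonal (fun b => (dN b)⁻¹) *ᵥ (P.GN zstar z)ᵀ *ᵥ w + E11 *ᵥ w +
      (P.GB zstar z - P.GB zstar zstar) *ᵥ y + E12 *ᵥ y := by
    have h3 := funext heq1
    rw [he1, ← h3]
    simp only [← Pi.add_def, add_mulVec, sub_mulVec, mulVec_mulVec, Matrix.mul_assoc]
    abel
  have h3 : evnorm ((P.Lzz z lam - L) *ᵥ w) ≤ KH * ((c + 1) * mu) * evnorm w :=
    (evnorm_mulVec_le _ _).trans (mul_le_mul_of_nonneg_right hLdiff hw0)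
  have h4 : evnorm (P.GN zstar z *ᵥ diagonal (fun b => (dN b)⁻¹) *ᵥ (P.GN zstar z)ᵀ *ᵥ w) ≤
      KG * (c * mu * (KG * evnorm w)) := by
    refine (evnorm_mulVec_le _ _).trans (mul_le_mul hGN ?_ (evnorm_nonneg _) hKG0)
    refine (evnorm_diagonal_mulVec_le (by positivity) hdNinv _).trans ?_
    refine mul_le_mul_of_nonneg_left ((evnorm_mulVec_le _ _).trans ?_) (by positivity)
    rw [mnorm_transpose]
    exact mul_le_mul_of_nonneg_right hGN hw0
  have h5 : evnorm (E11 *ᵥ w) ≤ kap * (u / mu + mu) * evnorm w :=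
    (evnorm_mulVec_le _ _).trans (mul_le_mul_of_nonneg_right hE11 hw0)
  have h6 : evnorm ((P.GB zstar z - P.GB zstar zstar) *ᵥ y) ≤ KG * (c + 1) * mu * evnorm y :=
    (evnorm_mulVec_le _ _).trans (mul_le_mul_of_nonneg_right hGBmu hy0)
  have h7 : evnorm (E12 *ᵥ y) ≤ kap * mu * evnorm y :=
    (evnorm_mulVec_le _ _).trans (mul_le_mul_of_nonneg_right
      (hE12.trans (mul_le_mul_of_nonneg_left hu2 hkap.le)) hy0)
  have h8 : evnorm e1 ≤ KH * ((c + 1) * mu) * evnorm w + KG * (c * mu * (KG * evnorm w)) +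
      kap * (u / mu + mu) * evnorm w + KG * (c + 1) * mu * evnorm y +
      kap * mu * evnorm y := by
    rw [he1']
    refine (evnorm_add_le _ _).trans (add_le_add ?_ h7)
    refine (evnorm_add_le _ _).trans (add_le_add ?_ h6)
    refine (evnorm_add_le _ _).trans (add_le_add ?_ h5)
    exact (evnorm_add_le _ _).trans (add_le_add h3 h4)
  have h9 : mu * evnorm w ≤ (u / mu + mu) * evnorm w :=
    mul_le_mul_of_nonneg_right (le_add_of_nonneg_left (by positivity)) hw0
  calc evnorm e1 ≤ (KH * (c + 1) + KG * (c * KG)) * (mu * evnorm w) +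
        kap * ((u / mu + mu) * evnorm w) + (KG * (c + 1) + kap) * (mu * evnorm y) :=
        h8.trans_eq (by ring)
    _ ≤ (KH * (c + 1) + KG * (c * KG)) * ((u / mu + mu) * evnorm w) +
        kap * ((u / mu + mu) * evnorm w) + (KG * (c + 1) + kap) * (mu * evnorm y) := by
        gcongr
    _ = (KH * (c + 1) + KG * (c * KG) + kap) * ((u / mu + mu) * evnorm w) +
        (KG * (c + 1) + kap) * (mu * evnorm y) := by ring
    _ ≤ K * ((u / mu + mu) * evnorm w) + K * (mu * evnorm y) := by
        gcongr
    _ = _ := by ring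

theorem evnorm_dual_residual_le (hmu : 0 < mu) (hu : 0 < u) (hu2 : u ≤ mu) (hkap : 0 < kap)
    (hK2 : KG * (c + 1) + kap ≤ K) (hK3 : kap ≤ K)
    (hGBmu : mnorm (P.GB zstar z - P.GB zstar zstar) ≤ KG * (c + 1) * mu)
    (hE21 : mnorm E21 ≤ kap * u) (hE22 : mnorm E22 ≤ kap * u)
    (heq2 : ∀ b, (((P.GB zstar z)ᵀ + E21) *ᵥ w) b + ((-diagonal dB + E22) *ᵥ y) b =
      ((P.GB zstar zstar)ᵀ *ᵥ r3) b + r4 b) :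
    evnorm ((P.GB zstar zstar)ᵀ *ᵥ r3 + r4 - (P.GB zstar zstar)ᵀ *ᵥ w + diagonal dB *ᵥ y) ≤
      K * (mu * evnorm w + u * evnorm y) := by
  set e2 := (P.GB zstar zstar)ᵀ *ᵥ r3 + r4 - (P.GB zstar zstar)ᵀ *ᵥ w + diagonal dB *ᵥ y with he2
  have hw0 := evnorm_nonneg w
  have hy0 := evnorm_nonneg y
  have he2' : e2 = (P.GB zstar z - P.GB zstar zstar)ᵀ *ᵥ w + E21 *ᵥ w + E22 *ᵥ y := by
    have h3 := funext heq2
    simp only [← Pi.add_def, add_mulVec, neg_mulVec] at h3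
    rw [he2, transpose_sub, sub_mulVec]
    linear_combination -h3
  have h6 : evnorm ((P.GB zstar z - P.GB zstar zstar)ᵀ *ᵥ w) ≤
      KG * (c + 1) * mu * evnorm w := by
    refine (evnorm_mulVec_le _ _).trans (mul_le_mul_of_nonneg_right ?_ hw0)
    rwa [mnorm_transpose]
  have h7 : evnorm (E21 *ᵥ w) ≤ kap * mu * evnorm w :=
    (evnorm_mulVec_le _ _).trans (mul_le_mul_of_nonneg_right
      (hE21.trans (mul_le_mul_of_nonneg_left hu2 hkap.le)) hw0)
  have h8 : evnorm (E22 *ᵥ y) ≤ kap * u * evnorm y :=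
    (evnorm_mulVec_le _ _).trans (mul_le_mul_of_nonneg_right hE22 hy0)
  calc evnorm e2 ≤ KG * (c + 1) * mu * evnorm w + kap * mu * evnorm w +
        kap * u * evnorm y := by
        rw [he2']
        refine (evnorm_add_le _ _).trans (add_le_add ?_ h8)
        exact (evnorm_add_le _ _).trans (add_le_add h6 h7)
    _ = (KG * (c + 1) + kap) * (mu * evnorm w) + kap * (u * evnorm y) := by ring
    _ ≤ K * (mu * evnorm w) + K * (u * evnorm y) := by
        gcongr
    _ = _ := by ring

end NLP

theorem SVDdata.exists_bounds_of_small_residual {n m : ℕ} {P : NLP n m} {zstar : Fin n → ℝ}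
    (SV : SVDdata P zstar) {K : ℝ} (hK1 : 1 ≤ K) :
    ∃ eps : ℝ, 0 < eps ∧ eps ≤ 1 ∧ ∃ C : ℝ, 0 < C ∧
      ∀ (L : Matrix (Fin n) (Fin n) ℝ) (dB : P.Bsub zstar → ℝ) (w r1 r3 e1 : Fin n → ℝ)
        (y r4 e2 : P.Bsub zstar → ℝ) (c s h mu u : ℝ),
        0 < c → c ≤ K → 0 < s → s⁻¹ ≤ K → 0 < h → h⁻¹ ≤ K → 0 < mu → 0 < u →
        mu ≤ eps → u / mu ≤ eps → mnorm L ≤ K →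
        (∀ j, s ≤ SV.sig j) →
        (∀ x, h * evnorm x ≤ evnorm ((SV.Vhatᵀ * L * SV.Vhat) *ᵥ x)) →
        (∀ b, c⁻¹ * mu ≤ dB b) → (∀ b, |dB b| ≤ c * mu) →
        evnorm e1 ≤ K * ((u / mu + mu) * evnorm w + mu * evnorm y) →
        evnorm e2 ≤ K * (mu * evnorm w + u * evnorm y) →
        L *ᵥ w + P.GB zstar zstar *ᵥ y + e1 = r1 →
        (P.GB zstar zstar)ᵀ *ᵥ w - diagonal dB *ᵥ y + e2 = (P.GB zstar zstar)ᵀ *ᵥ r3 + r4 →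
        evnorm (SV.Uᵀ *ᵥ y) + evnorm (SV.Vhatᵀ *ᵥ w) + evnorm (SV.Uhatᵀ *ᵥ w) ≤
            C * (evnorm r1 + evnorm r3 + evnorm r4) ∧
          evnorm (SV.Vᵀ *ᵥ y) ≤ C * (evnorm r1 + evnorm r3 + evnorm r4 / mu) := by
  obtain ⟨eps, heps, heps1, C, hC, hmain⟩ := exists_rescaled_bounds hK1
  refine ⟨eps, heps, heps1, C, hC, ?_⟩
  intro L dB w r1 r3 e1 y r4 e2 c s h mu u hc0 hcK hs hsK hh hhK hmu hu hmu1 hum hL hsle hhle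
    ht hT he1le he2le h1 h2
  have hT0 : 0 ≤ c * mu := by positivity
  exact hmain c s h mu u _ _ _ _ _ _ _ _ _ _ _ _ hc0 hcK hs hsK hh hhK hmu hu hmu1 hum
    (evnorm_nonneg _) (evnorm_nonneg _) (evnorm_nonneg _) (evnorm_nonneg _) (evnorm_nonneg _)
    (evnorm_nonneg _) (evnorm_nonneg _) (evnorm_nonneg _) (evnorm_nonneg _) hL
    (SV.evnorm_primal_le w) (SV.evnorm_dual_le y) he1le he2le
    (SV.evnorm_V_le ht hT0 hT h2) (SV.evnorm_Uhat_le hs.le hsle hT0 hT h2)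
    (SV.evnorm_Vhat_le hhle h1) (SV.evnorm_U_le hs.le hsle h1)

/-- **perturbed reduced augmented system.** Fix `c ≥ 1` and `κ > 0`,
and suppose `z*` is a solution at which MFCQ holds (so `S` is compact).  Then there
exist `β₀ > 0`, `ε > 0` and `C₁ > 0` such that for any `μ, u > 0` with `μ ≤ ε` and
`u/μ ≤ ε`, for any `(z,λ)` with `δ(z,λ) ≤ cμ`, any positive diagonal matrices
`D_B`, `D_N` whose diagonal entries lie in `[c⁻¹μ, cμ]` and `[c⁻¹μ⁻¹, cμ⁻¹]`
respectively, any perturbation matrices with `‖Ẽ₁₁‖ ≤ κ(u/μ + μ)` and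
`‖Ẽ₁₂‖, ‖Ẽ₂₁‖, ‖Ẽ₂₂‖ ≤ κu`, and provided that for some `β ≥ β₀` both
`σ_min(Σ) ≥ β·max(μ^{1/3}, u/μ)` and
`σ_min(V̂ᵀL_zz(z*,λ*)V̂) ≥ β·max(μ^{1/3}, u/μ)` for all `λ* ∈ S_λ`, any solution
`(w,y)` of the perturbed system satisfies the stated bounds. -/
theorem stmt5_perturbed_reduced_system
    {n m : ℕ} (P : NLP n m) (zstar : Fin n → ℝ) (SV : SVDdata P zstar)
    (hsol : P.isSolution zstar)
    (hmfcq : P.MFCQ zstar)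
    (c kap : ℝ) (hc : 1 ≤ c) (hkap : 0 < kap) :
    ∃ beta0 : ℝ, 0 < beta0 ∧ ∃ eps : ℝ, 0 < eps ∧ ∃ C₁ : ℝ, 0 < C₁ ∧
      ∀ (mu u : ℝ), 0 < mu → 0 < u → mu ≤ eps → u / mu ≤ eps →
      ∀ (z : Fin n → ℝ) (lam : Fin m → ℝ),
        P.delta zstar z lam ≤ c * mu →
      ∀ (dB : P.Bsub zstar → ℝ) (dN : P.Nsub zstar → ℝ),
        (∀ b, c⁻¹ * mu ≤ dB b ∧ dB b ≤ c * mu) →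
        (∀ b, c⁻¹ * mu⁻¹ ≤ dN b ∧ dN b ≤ c * mu⁻¹) →
      ∀ (E11 : Matrix (Fin n) (Fin n) ℝ) (E12 : Matrix (Fin n) (P.Bsub zstar) ℝ)
        (E21 : Matrix (P.Bsub zstar) (Fin n) ℝ)
        (E22 : Matrix (P.Bsub zstar) (P.Bsub zstar) ℝ),
        mnorm E11 ≤ kap * (u / mu + mu) →
        mnorm E12 ≤ kap * u → mnorm E21 ≤ kap * u → mnorm E22 ≤ kap * u →
      ∀ beta : ℝ, beta0 ≤ beta →
        beta * max (mu ^ ((1 : ℝ)/3)) (u / mu) ≤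
          sigmaMin (Matrix.diagonal SV.sig) →
        (∀ ls ∈ P.Slam zstar,
          beta * max (mu ^ ((1 : ℝ)/3)) (u / mu) ≤
            sigmaMin (SV.Vhatᵀ * P.Lzz zstar ls * SV.Vhat)) →
      ∀ (w r1 r3 : Fin n → ℝ) (y r4 : P.Bsub zstar → ℝ),
        (∀ j, (((P.Lzz z lam +
              P.GN zstar z * Matrix.diagonal (fun b => (dN b)⁻¹) * (P.GN zstar z)ᵀ)
              + E11).mulVec w) j + ((P.GB zstar z + E12).mulVec y) j = r1 j) →
        (∀ b, (((P.GB zstar z)ᵀ + E21).mulVec w) b +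
            ((-(Matrix.diagonal dB) + E22).mulVec y) b =
              (((P.GB zstar zstar)ᵀ).mulVec r3) b + r4 b) →
        evnorm (SV.Uᵀ.mulVec y) + evnorm (SV.Vhatᵀ.mulVec w) +
            evnorm (SV.Uhatᵀ.mulVec w) ≤
          C₁ * (evnorm r1 + evnorm r3 + evnorm r4) ∧
        evnorm (SV.Vᵀ.mulVec y) ≤
          C₁ * (evnorm r1 + evnorm r3 + evnorm r4 / mu) := by
  obtain ⟨M, -, hM⟩ := hmfcq.exists_bound
  by_cases hpos : ∀ ls ∈ P.Slam zstar, ∀ x, evnorm x = 1 →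
      0 < evnorm ((SV.Vhatᵀ * P.Lzz zstar ls * SV.Vhat) *ᵥ x)
  swap
  · push Not at hpos
    obtain ⟨ls, hls, x, hx, hle⟩ := hpos
    refine ⟨1, one_pos, 1, one_pos, 1, one_pos, ?_⟩
    intro mu u hmu hu _ _ z lam _ dB dN _ _ E11 E12 E21 E22 _ _ _ _ beta hbeta _ hV
    have h0 : 0 < beta * max (mu ^ ((1 : ℝ) / 3)) (u / mu) :=
      mul_pos (by linarith) (lt_max_of_lt_right (by positivity))
    linarith [hV ls hls, sigmaMin_le (SV.Vhatᵀ * P.Lzz zstar ls * SV.Vhat) hx]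
  obtain ⟨h, hh, hhle⟩ := hmfcq.exists_uniform_lower_bound SV.Vhat hpos
  obtain ⟨s, hs, hsle⟩ := SV.exists_pos_le_sig
  obtain ⟨KL, hKL0, hKL⟩ := P.exists_mnorm_Lzz_le zstar M
  obtain ⟨KH, hKH0, hKH⟩ := P.exists_mnorm_Lzz_sub_le zstar M
  obtain ⟨r, hr, KG, hKG0, hKG⟩ := P.exists_mnorm_gradg_bounds zstar
  have hne : (P.Slam zstar).Nonempty := hsol.2.1
  set K := c + kap + s⁻¹ + h⁻¹ + KL + (KH * (c + 1) + KG * (c * KG) + kap) +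
    (KG * (c + 1) + kap) with hK
  have hsi : 0 < s⁻¹ := inv_pos.2 hs
  have hhi : 0 < h⁻¹ := inv_pos.2 hh
  have hc0 : 0 < c := by linarith
  have hH0 : 0 ≤ KH * (c + 1) := by positivity
  have hN0 : 0 ≤ KG * (c * KG) := by positivity
  have hG0 : 0 ≤ KG * (c + 1) := by positivity
  have hK1 : 1 ≤ K := by linarith
  obtain ⟨eps, heps, heps1, C, hC, hmain⟩ := SV.exists_bounds_of_small_residual hK1
  refine ⟨1, one_pos, min eps (min r 1 / (c + 1)), by positivity, C, hC, ?_⟩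
  intro mu u hmu hu hmue hue z lam hdelta dB dN hdB hdN E11 E12 E21 E22 hE11 hE12 hE21 hE22
    beta _ _ _ w r1 r3 y r4 heq1 heq2
  have hmu1 : mu ≤ eps := hmue.trans (min_le_left _ _)
  have hmu2 : (c + 1) * mu ≤ min r 1 := by
    rw [mul_comm, ← le_div_iff₀ (by linarith)]
    exact hmue.trans (min_le_right _ _)
  have hum : u / mu ≤ eps := hue.trans (min_le_left _ _)
  have hu1 : u ≤ eps * mu := (div_le_iff₀ hmu).1 hum
  have hu2 : u ≤ mu := hu1.trans (mul_le_of_le_one_left hmu.le heps1)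
  obtain ⟨ls, hls, hz, hlam⟩ := P.exists_mem_Slam_near hne
    (hdelta.trans_lt (show c * mu < (c + 1) * mu by linarith))
  obtain ⟨hGB, hGN⟩ := hKG z (hz.trans (hmu2.trans (min_le_left _ _)))
  have hLdiff := hKH z lam ls (hM ls hls) _ (hmu2.trans (min_le_right _ _)) hz hlam
  have hL := hKL ls (hM ls hls)
  have hGBmu : mnorm (P.GB zstar z - P.GB zstar zstar) ≤ KG * (c + 1) * mu := by
    rw [mul_assoc]
    exact hGB.trans (mul_le_mul_of_nonneg_left hz hKG0)
  have hdNinv : ∀ b, |(dN b)⁻¹| ≤ c * mu := fun b => by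
    have h3 : 0 < c⁻¹ * mu⁻¹ := by positivity
    rw [abs_of_pos (inv_pos.2 (h3.trans_le (hdN b).1))]
    calc (dN b)⁻¹ ≤ (c⁻¹ * mu⁻¹)⁻¹ := inv_anti₀ h3 (hdN b).1
      _ = c * mu := by rw [mul_inv, inv_inv, inv_inv]
  have hdBabs : ∀ b, |dB b| ≤ c * mu := fun b => by
    rw [abs_of_nonneg (le_trans (by positivity) (hdB b).1)]
    exact (hdB b).2
  exact hmain (P.Lzz zstar ls) dB w r1 r3 _ y r4 _ c s h mu u hc0 (by linarith) hs (by linarith)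
    hh (by linarith) hmu hu hmu1 hum (hL.trans (by linarith)) hsle (hhle ls hls)
    (fun b => (hdB b).1) hdBabs
    (P.evnorm_primal_residual_le hmu hu hu2 hc0 hkap hKH0 hKG0 (by linarith) (by linarith)
      hLdiff hGN hGBmu hdNinv hE11 hE12 heq1)
    (P.evnorm_dual_residual_le hmu hu hu2 hkap (by linarith) (by linarith)
      hGBmu hE21 hE22 heq2)
    (by abel) (by abel)
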